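/- Let C ⊆ ℝ^d be a convex set admitting an ε-MILEF of complexity (m,k) with k ≥ 1, where ε ∈ [0,1]. Then there exists a universal constant c > 0 (independent of C, d, m, k, ε, δ) such that for every δ ∈ (0,1], C admits an (ε+δ)-LEF of size at most m·(1 + k/δ)^{c·k}. -/

import Mathlib

open scoped ENNReal Pointwise

/-- The relative distance between two sets `A ⊆ B ⊆ ℝ^ι`:
`rdist(A,B) = sup_{π linear} d_H(π(A),π(B)) / diam(π(A))`, computed in `ℝ≥0∞`,
so that a fraction with `∞` in the denominator as well as `0/0` is `0`,
`rdist(∅,∅) = 0` and `rdist(∅,B) = ∞` for `B ≠ ∅`. -/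
noncomputable def relDist {ι : Type*} (A B : Set (ι → ℝ)) : ℝ≥0∞ :=
  ⨆ π : (ι → ℝ) →ₗ[ℝ] ℝ,
    (⨆ b ∈ B, ⨅ a ∈ A, ENNReal.ofReal |π b - π a|) /
      (⨆ a ∈ A, ⨆ a' ∈ A, ENNReal.ofReal |π a - π a'|)

/-- A point of `ℝ^k` all of whose coordinates are integers. -/
def IsLatticePoint {k : ℕ} (z : Fin k → ℝ) : Prop := ∀ i, ∃ n : ℤ, z i = (n : ℝ)

/-- `Q` is a polyhedron given as the intersection of an affine subspace with at most `m`
closed halfspaces (`m` serving as the number of facets). -/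
def IsPolyhedronOfSize {ι : Type*} (Q : Set (ι → ℝ)) (m : ℕ) : Prop :=
  ∃ (S : AffineSubspace ℝ (ι → ℝ)) (nh : ℕ), nh ≤ m ∧
    ∃ (f : Fin nh → ((ι → ℝ) →ₗ[ℝ] ℝ)) (b : Fin nh → ℝ),
      Q = (S : Set (ι → ℝ)) ∩ {x | ∀ i, f i x ≤ b i}

/-- `Q` is a polyhedron. -/
def IsPolyhedron {ι : Type*} (Q : Set (ι → ℝ)) : Prop := ∃ m, IsPolyhedronOfSize Q m

/-- `C` admits an `ε`-LEF of size `m`: a polyhedron `Q ⊆ ℝ^ℓ` with at most `m` facets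
and an affine map `π` with `C ⊆ π(Q)` and `rdist(C, π(Q)) ≤ ε`. -/
def IsLEF {ι : Type*} (C : Set (ι → ℝ)) (ε : ℝ) (m : ℕ) : Prop :=
  ∃ (l : ℕ) (Q : Set (Fin l → ℝ)) (π : (Fin l → ℝ) →ᵃ[ℝ] (ι → ℝ)),
    IsPolyhedronOfSize Q m ∧ C ⊆ π '' Q ∧ relDist C (π '' Q) ≤ ENNReal.ofReal ε

/-- `C` admits an `ε`-MILEF of complexity `(m, k)`: a polyhedron `Q ⊆ ℝ^ℓ` with at most `m`
facets together with affine maps `σ : ℝ^ℓ → ℝ^k` and `π : ℝ^ℓ → ℝ^ι` such that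
`C̄ := conv(π(Q ∩ σ⁻¹(ℤ^k)))` satisfies `C ⊆ C̄` and `rdist(C, C̄) ≤ ε`. -/
def IsMILEF {ι : Type*} (C : Set (ι → ℝ)) (ε : ℝ) (m k : ℕ) : Prop :=
  ∃ (l : ℕ) (Q : Set (Fin l → ℝ)) (σ : (Fin l → ℝ) →ᵃ[ℝ] (Fin k → ℝ))
    (π : (Fin l → ℝ) →ᵃ[ℝ] (ι → ℝ)),
    IsPolyhedronOfSize Q m ∧
    C ⊆ convexHull ℝ (π '' (Q ∩ {x | IsLatticePoint (σ x)})) ∧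
    relDist C (convexHull ℝ (π '' (Q ∩ {x | IsLatticePoint (σ x)}))) ≤ ENNReal.ofReal ε

theorem exists_int_comb_abs_le {n : ℕ} (hn : 0 < n) (b : Module.Basis (Fin n) ℝ (Fin n → ℝ))
    {r : ℝ} (hr : 0 ≤ r) (hdet : |(Matrix.of b).det| ≤ r ^ n) :
    ∃ x : Fin n → ℤ, x ≠ 0 ∧ ∀ j, |∑ i, (x i : ℝ) * b i j| ≤ r := by
  classical
  have : Nonempty (Fin n) := ⟨⟨0, hn⟩⟩
  have : Countable (Submodule.span ℤ (Set.range b)).toAddSubgroup :=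
    inferInstanceAs (Countable (Submodule.span ℤ (Set.range b)))
  obtain ⟨v, hv0, hv⟩ := MeasureTheory.exists_ne_zero_mem_lattice_of_measure_mul_two_pow_le_measure
    (ZSpan.isAddFundamentalDomain' b MeasureTheory.volume)
    (s := Metric.closedBall (0 : Fin n → ℝ) r) (by simp) (convex_closedBall _ _)
    (isCompact_closedBall _ _) (by
      rw [ZSpan.volume_fundamentalDomain, Real.volume_pi_closedBall _ hr]
      simp only [Module.finrank_fin_fun, Fintype.card_fin, mul_pow]
      rw [mul_comm, ENNReal.ofReal_mul (by positivity)]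
      gcongr
      rw [ENNReal.ofReal_pow (by norm_num)]; norm_num)
  obtain ⟨x, hx⟩ := (Submodule.mem_span_range_iff_exists_fun ℤ).1 v.2
  refine ⟨x, ?_, fun j => ?_⟩
  · rintro rfl
    exact hv0 (Subtype.ext (by simpa using hx.symm))
  · have h1 : ((v : Fin n → ℝ)) j = ∑ i, (x i : ℝ) * b i j := by
      rw [← hx]; simp [Finset.sum_apply]
    rw [← h1]
    have := (norm_le_pi_norm (v : Fin n → ℝ) j).trans (by simpa using hv)
    simpa using this

open scoped Matrix in
theorem exists_int_comb_dual_pair {n : ℕ} (hn : 0 < n) (M : Matrix (Fin n) (Fin n) ℝ)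
    (hM : M.det ≠ 0) :
    ∃ (x y : Fin n → ℤ) (r s : ℝ), x ≠ 0 ∧ y ≠ 0 ∧ 0 ≤ r ∧ 0 ≤ s ∧ r * s = 1 ∧
      (∀ j, |∑ i, (x i : ℝ) * M i j| ≤ r) ∧ ∀ j, |∑ i, (y i : ℝ) * (M⁻¹)ᵀ i j| ≤ s := by
  have key : ∀ N : Matrix (Fin n) (Fin n) ℝ, N.det ≠ 0 → ∀ r : ℝ, 0 ≤ r → |N.det| ≤ r ^ n →
      ∃ x : Fin n → ℤ, x ≠ 0 ∧ ∀ j, |∑ i, (x i : ℝ) * N i j| ≤ r := by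
    intro N hN r hr hle
    have hli : LinearIndependent ℝ N := Matrix.linearIndependent_rows_of_det_ne_zero hN
    have : Nonempty (Fin n) := ⟨⟨0, hn⟩⟩
    let b := basisOfLinearIndependentOfCardEqFinrank hli (by simp)
    have hb : ∀ i, b i = N i := fun i => by
      exact congrFun (coe_basisOfLinearIndependentOfCardEqFinrank hli _) i
    obtain ⟨x, hx, hx'⟩ := exists_int_comb_abs_le hn b hr (by
      convert hle using 3
      ext i j; simp [hb])
    exact ⟨x, hx, by simpa [hb] using hx'⟩
  have hn' : (n : ℝ) ≠ 0 := by positivity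
  obtain ⟨x, hx, hx'⟩ := key M hM (|M.det| ^ (1 / n : ℝ)) (by positivity) (by
    rw [one_div, Real.rpow_inv_natCast_pow (abs_nonneg _) hn.ne'])
  have hM' : ((M⁻¹)ᵀ).det = (M.det)⁻¹ := by
    rw [Matrix.det_transpose, Matrix.det_nonsing_inv, Ring.inverse_eq_inv']
  obtain ⟨y, hy, hy'⟩ := key (M⁻¹)ᵀ (by rw [hM']; exact inv_ne_zero hM)
    ((|M.det| ^ (1 / n : ℝ))⁻¹) (by positivity) (by
    rw [hM', inv_pow, abs_inv, one_div, Real.rpow_inv_natCast_pow (abs_nonneg _) hn.ne'])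
  refine ⟨x, y, _, _, hx, hy, ?_, ?_, ?_, hx', hy'⟩
  · positivity
  · positivity
  · exact mul_inv_cancel₀ (by have := abs_pos.2 hM; positivity)

theorem EuclideanSpace.norm_le_sqrt_mul_of_abs_le {ι : Type*} [Fintype ι] (x : EuclideanSpace ℝ ι)
    {r : ℝ} (hr : 0 ≤ r) (h : ∀ i, |x i| ≤ r) : ‖x‖ ≤ √(Fintype.card ι) * r := by
  rw [EuclideanSpace.norm_eq]
  refine Real.sqrt_le_iff.2 ⟨by positivity, ?_⟩
  rw [mul_pow, Real.sq_sqrt (by positivity)]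
  calc ∑ i, ‖x i‖ ^ 2 ≤ ∑ _i : ι, r ^ 2 := by
        gcongr with i; exact h i
    _ = _ := by simp

open scoped Matrix in
theorem exists_short_vector_dual_vector {E : Type*} [NormedAddCommGroup E] [InnerProductSpace ℝ E]
    [FiniteDimensional ℝ E] (hE : 0 < Module.finrank ℝ E) (L : Submodule ℤ E)
    [DiscreteTopology L] [IsZLattice ℝ L] :
    ∃ v ∈ L, v ≠ 0 ∧ ∃ w : E, w ≠ 0 ∧ (∀ x ∈ L, ∃ m : ℤ, inner ℝ w x = m) ∧
      ‖v‖ * ‖w‖ ≤ Module.finrank ℝ E := by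
  classical
  set n := Module.finrank ℝ E with hn
  let o := stdOrthonormalBasis ℝ E
  have := ZLattice.module_finite ℝ L
  have := ZLattice.module_free ℝ L
  let e₀ : Module.Basis (Fin n) ℤ L := Module.finBasisOfFinrankEq ℤ L (ZLattice.rank ℝ L)
  let e : Module.Basis (Fin n) ℝ E := e₀.ofZLatticeBasis ℝ L
  have he : ∀ i, e i = e₀ i := fun i => e₀.ofZLatticeBasis_apply ℝ L i
  let M : Matrix (Fin n) (Fin n) ℝ := fun i j => inner ℝ (o j) (e i)
  have hMT : Mᵀ = o.toBasis.toMatrix e := by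
    ext i j
    rw [Matrix.transpose_apply, Module.Basis.toMatrix_apply,
      OrthonormalBasis.coe_toBasis_repr_apply,
      OrthonormalBasis.repr_apply_apply]
  have hM : M.det ≠ 0 := by
    rw [← Matrix.det_transpose, hMT]
    have := (o.toBasis.isUnit_det e).ne_zero
    rwa [Module.Basis.det_apply] at this
  obtain ⟨x, y, r, s, hx, hy, hr, hs, hrs, hx', hy'⟩ := exists_int_comb_dual_pair hE M hM
  let v : E := ∑ i, (x i : ℝ) • e i
  let W : EuclideanSpace ℝ (Fin n) :=
    WithLp.toLp 2 (fun j => ∑ i, (y i : ℝ) * (M⁻¹)ᵀ i j)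
  let w : E := o.repr.symm W
  have hv : ‖v‖ ≤ √n * r := by
    rw [← o.repr.norm_map]
    have := EuclideanSpace.norm_le_sqrt_mul_of_abs_le (o.repr v) hr (fun j => by
      rw [OrthonormalBasis.repr_apply_apply]
      simpa [v, inner_sum, inner_smul_right] using hx' j)
    simpa using this
  have hw : ‖w‖ ≤ √n * s := by
    rw [LinearIsometryEquiv.norm_map]
    have := EuclideanSpace.norm_le_sqrt_mul_of_abs_le W hs hy'
    simpa using this
  have hwe : ∀ i, inner ℝ w (e i) = (y i : ℝ) := by
    intro i
    have h1 : inner ℝ w (e i) = ∑ j, W j * M i j := by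
      rw [← o.sum_inner_mul_inner w (e i)]
      refine Finset.sum_congr rfl fun j _ => ?_
      have : inner ℝ w (o j) = W j := by
        rw [real_inner_comm, ← OrthonormalBasis.repr_apply_apply]; simp [w]
      rw [this]
    have h2 : ∑ j, W j * M i j = M.mulVec (M⁻¹.mulVec (fun i => (y i : ℝ))) i := by
      simp only [Matrix.mulVec, dotProduct, W, Matrix.transpose_apply]
      refine Finset.sum_congr rfl fun j _ => ?_
      rw [mul_comm]
      simp [mul_comm]
    rw [h1, h2, Matrix.mulVec_mulVec, Matrix.mul_nonsing_inv _ (isUnit_iff_ne_zero.2 hM)]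
    simp
  refine ⟨v, ?_, ?_, w, ?_, ?_, ?_⟩
  · refine Submodule.sum_mem _ fun i _ => ?_
    rw [he, Int.cast_smul_eq_zsmul]
    exact L.smul_mem _ (e₀ i).2
  · intro h0
    have := Fintype.linearIndependent_iff.1 e.linearIndependent _ h0
    exact hx (funext fun i => by simpa using this i)
  · intro h0
    refine hy (funext fun i => ?_)
    have := hwe i
    rw [h0, inner_zero_left] at this
    exact_mod_cast this.symm
  · intro z hz
    refine ⟨∑ i, e₀.repr ⟨z, hz⟩ i * y i, ?_⟩
    have h1 : z = ∑ i, (e₀.repr ⟨z, hz⟩ i : ℝ) • e i := by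
      conv_lhs => rw [← e.sum_repr z]
      refine Finset.sum_congr rfl fun i _ => ?_
      congr 1
      exact e₀.ofZLatticeBasis_repr_apply ℝ L ⟨z, hz⟩ i
    conv_lhs => rw [h1]
    simp [inner_sum, inner_smul_right, hwe]
  · calc ‖v‖ * ‖w‖ ≤ (√n * r) * (√n * s) := by gcongr
      _ = (√n * √n) * (r * s) := by ring
      _ = n := by rw [hrs, Real.mul_self_sqrt (by positivity), mul_one]

/-- Every ball contains only finitely many points of `L`. -/
def FiniteInBalls {V : Type*} [NormedAddCommGroup V] (L : Submodule ℤ V) : Prop :=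
  ∀ r : ℝ, {x | x ∈ L ∧ ‖x‖ ≤ r}.Finite

theorem FiniteInBalls.discreteTopology {V : Type*} [NormedAddCommGroup V] {L : Submodule ℤ V}
    (hL : FiniteInBalls L) : DiscreteTopology L := by
  refine discreteTopology_of_isOpen_singleton_zero ?_
  have hfin : {x : L | ‖(x : V)‖ ≤ 1 ∧ x ≠ 0}.Finite := by
    refine Set.Finite.of_finite_image ((hL 1).subset ?_) Subtype.val_injective.injOn
    rintro _ ⟨x, hx, rfl⟩
    exact ⟨x.2, hx.1⟩
  have : ({0} : Set L) = Metric.ball 0 1 \ {x : L | ‖(x : V)‖ ≤ 1 ∧ x ≠ 0} := by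
    ext x
    simp only [Set.mem_singleton_iff, Set.mem_sdiff, mem_ball_zero_iff, Set.mem_ofPred_eq, not_and,
      not_not]
    refine ⟨?_, fun h => h.2 (by simpa using h.1.le)⟩
    rintro rfl
    simp
  rw [this]
  exact Metric.isOpen_ball.sdiff hfin.isClosed

theorem exists_mem_lattice_norm_sub_le (n : ℕ) : ∀ (E : Type) [NormedAddCommGroup E]
    [InnerProductSpace ℝ E] [FiniteDimensional ℝ E], Module.finrank ℝ E = n →
    ∀ L : Submodule ℤ E, FiniteInBalls L → ∀ lam : ℝ, 0 < lam →
    (∀ y : E, y ≠ 0 → (∀ x ∈ L, ∃ m : ℤ, inner ℝ y x = m) → lam ≤ ‖y‖) →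
    ∀ x : E, ∃ z ∈ L, ‖x - z‖ ≤ (n : ℝ) ^ 2 / lam := by
  induction n with
  | zero =>
    intro E _ _ _ hE L _ lam _ _ x
    have := Module.finrank_zero_iff.1 hE
    exact ⟨0, L.zero_mem, by simp [Subsingleton.elim x 0]⟩
  | succ n ih =>
    intro E _ _ _ hE L hL lam hlam hdual x
    have hdisc := hL.discreteTopology
    have hspan : IsZLattice ℝ L := by
      refine ⟨?_⟩
      by_contra hne
      have hbot : (Submodule.span ℝ (L : Set E))ᗮ ≠ ⊥ :=
        fun h => hne (Submodule.orthogonal_eq_bot_iff.1 h)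
      obtain ⟨y, hy, hy0⟩ := Submodule.exists_mem_ne_zero_of_ne_bot hbot
      have hpos : 0 < ‖y‖ := norm_pos_iff.2 hy0
      have := hdual ((lam / 2 / ‖y‖) • y) (smul_ne_zero (by positivity) hy0) (fun z hz =>
        ⟨0, by
          rw [inner_smul_left, Submodule.inner_left_of_mem_orthogonal (Submodule.subset_span hz) hy]
          simp⟩)
      rw [norm_smul, Real.norm_of_nonneg (by positivity), div_mul_cancel₀ _ hpos.ne'] at this
      linarith
    obtain ⟨b, hbL, hb0, w, hw0, hwL, hbw⟩ := exists_short_vector_dual_vector (by omega) L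
    have hb : ‖b‖ ≤ (n + 1) / lam := by
      rw [le_div_iff₀ hlam]
      rw [hE] at hbw
      push_cast at hbw
      exact (mul_le_mul_of_nonneg_left (hdual w hw0 hwL) (norm_nonneg b)).trans hbw
    let P := (ℝ ∙ b)ᗮ.orthogonalProjectionOnto
    have hP : ∀ v : E, ∃ t : ℝ, v = (P v : E) + t • b := by
      intro v
      have h := Submodule.sub_starProjection_mem_orthogonal (K := (ℝ ∙ b)ᗮ) v
      rw [Submodule.orthogonal_orthogonal] at h
      obtain ⟨t, ht⟩ := Submodule.mem_span_singleton.1 h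
      exact ⟨t, by rw [ht]; simp [P]⟩
    have hPb : P b = 0 := by
      refine Submodule.orthogonalProjectionOnto_apply_of_mem_orthogonal ?_
      rw [Submodule.orthogonal_orthogonal]
      exact Submodule.mem_span_singleton_self b
    have hround : ∀ (t : ℝ) (u : E), ‖u + t • b - (round t : ℤ) • b‖ ≤ ‖u‖ + ‖b‖ / 2 := by
      intro t u
      have : u + t • b - (round t : ℤ) • b = u + (t - round t) • b := by
        rw [← Int.cast_smul_eq_zsmul ℝ, sub_smul]; abel
      rw [this]
      refine (norm_add_le _ _).trans ?_
      rw [norm_smul, Real.norm_eq_abs]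
      have := mul_le_mul_of_nonneg_right (abs_sub_round t) (norm_nonneg b)
      linarith
    let L' : Submodule ℤ (ℝ ∙ b)ᗮ := L.map (P.toLinearMap.restrictScalars ℤ)
    have hL' : FiniteInBalls L' := by
      intro r
      refine ((hL (r + ‖b‖ / 2)).image P).subset ?_
      rintro y ⟨⟨v, hv, rfl⟩, hr⟩
      obtain ⟨t, ht⟩ := hP v
      refine ⟨v - (round t : ℤ) • b, ⟨L.sub_mem hv (L.smul_mem _ hbL), ?_⟩, ?_⟩
      · have := hround t (P v : E)
        rw [← ht] at this
        have hr' : ‖(P v : E)‖ ≤ r := hr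
        linarith
      · simp [hPb]
    have : Fact (Module.finrank ℝ E = n + 1) := ⟨hE⟩
    obtain ⟨z', ⟨v, hv, hvz⟩, hz'⟩ := ih (ℝ ∙ b)ᗮ
      (Submodule.finrank_orthogonal_span_singleton hb0) L' hL' lam hlam (by
      intro y hy hyL
      refine hdual y (by simpa using hy) fun z hz => ?_
      obtain ⟨m, hm⟩ := hyL (P z) ⟨z, hz, rfl⟩
      refine ⟨m, ?_⟩
      rw [← hm]
      exact (Submodule.inner_orthogonalProjectionOnto_eq_of_mem_left y z).symm) (P x)
    obtain ⟨t, ht⟩ := hP (x - v)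
    refine ⟨v + (round t : ℤ) • b, L.add_mem hv (L.smul_mem _ hbL), ?_⟩
    have h1 := hround t (P (x - v) : E)
    rw [← ht] at h1
    have h2 : ‖(P (x - v) : E)‖ ≤ (n : ℝ) ^ 2 / lam := by
      have hvz' : P v = z' := hvz
      rw [map_sub, hvz']
      exact hz'
    rw [← sub_sub]
    calc _ ≤ (n : ℝ) ^ 2 / lam + (n + 1) / lam := by
          have := norm_nonneg b
          linarith
      _ = ((n : ℝ) ^ 2 + (n + 1)) / lam := by ring
      _ ≤ _ := by
        push_cast
        gcongr
        nlinarith [(Nat.cast_nonneg n : (0 : ℝ) ≤ n)]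

theorem FiniteInBalls.map_linearEquiv {V W : Type*} [NormedAddCommGroup V] [NormedSpace ℝ V]
    [NormedAddCommGroup W] [NormedSpace ℝ W] [FiniteDimensional ℝ W] {L : Submodule ℤ V}
    (hL : FiniteInBalls L) (T : V ≃ₗ[ℝ] W) :
    FiniteInBalls (L.map (T.toLinearMap.restrictScalars ℤ)) := by
  intro r
  let S := T.symm.toLinearMap.toContinuousLinearMap
  refine ((hL (‖S‖ * r)).image T).subset ?_
  rintro _ ⟨⟨x, hx, rfl⟩, hr⟩
  refine ⟨x, ⟨hx, ?_⟩, rfl⟩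
  have h1 : S (T x) = x := T.symm_apply_apply x
  rw [← h1]
  exact (S.le_opNorm _).trans (mul_le_mul_of_nonneg_left hr (norm_nonneg _))

theorem exists_basis_abs_repr_le_one {V : Type*} [AddCommGroup V] [Module ℝ V]
    [FiniteDimensional ℝ V] {n : ℕ} (hV : Module.finrank ℝ V = n) (G : Finset V)
    (hG : Submodule.span ℝ (G : Set V) = ⊤) :
    ∃ b : Module.Basis (Fin n) ℝ V, (∀ i, b i ∈ G) ∧ ∀ g ∈ G, ∀ i, |b.repr g i| ≤ 1 := by
  classical
  let β := Module.finBasisOfFinrankEq ℝ V hV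
  obtain ⟨f, hfG, hfspan, hfli⟩ : ∃ f : Fin n → V, (∀ i, f i ∈ G) ∧
      Submodule.span ℝ (Set.range f) = ⊤ ∧ LinearIndependent ℝ f := by
    have hfr : Module.finrank ℝ (Submodule.span ℝ (G : Set V)) = n := by
      rw [hG, finrank_top, hV]
    have h := Submodule.exists_fun_fin_finrank_span_eq ℝ (G : Set V)
    rw [hfr, hG] at h
    exact h
  obtain ⟨u, hu, humax⟩ := (Fintype.piFinset fun _ : Fin n => G).exists_max_image
    (fun u => |β.det u|) ⟨f, by simpa using hfG⟩
  have hudet : β.det u ≠ 0 := by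
    have h1 := humax f (by simpa using hfG)
    have h2 : β.det f ≠ 0 := (β.is_basis_iff_det.1 ⟨hfli, hfspan⟩).ne_zero
    intro h0
    rw [h0, abs_zero] at h1
    exact h2 (abs_eq_zero.1 (le_antisymm h1 (abs_nonneg _)))
  obtain ⟨hli, hsp⟩ := β.is_basis_iff_det.2 (isUnit_iff_ne_zero.2 hudet)
  refine ⟨Module.Basis.mk hli hsp.ge, fun i => ?_, fun g hg i => ?_⟩
  · rw [Module.Basis.mk_apply]
    exact Fintype.mem_piFinset.1 hu i
  · have h1 := LinearMap.congr_fun (β.det_smul_mk_coord_eq_det_update hli hsp.ge i) g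
    have h2 : β.det u * (Module.Basis.mk hli hsp.ge).repr g i = β.det (Function.update u i g) := by
      simpa using h1
    have h3 := humax (Function.update u i g) (Fintype.mem_piFinset.2 fun j => by
      by_cases hj : j = i
      · subst hj; simpa using hg
      · rw [Function.update_of_ne hj]; exact Fintype.mem_piFinset.1 hu j)
    simp only [← h2, abs_mul] at h3
    exact le_of_mul_le_mul_left (by simpa using h3) (abs_pos.2 hudet)

theorem exists_lattice_mem_convexHull {V : Type} [NormedAddCommGroup V] [NormedSpace ℝ V]
    [FiniteDimensional ℝ V] {n : ℕ} (hn : 0 < n) (hV : Module.finrank ℝ V = n)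
    (L : Submodule ℤ V) (hL : FiniteInBalls L) (F : Finset V) (v₀ : V) (hv₀ : v₀ ∈ F)
    (hspan : Submodule.span ℝ ((fun v => v - v₀) '' (F : Set V)) = ⊤)
    (hwidth : ∀ φ : V →ₗ[ℝ] ℝ, φ ≠ 0 → (∀ x ∈ L, ∃ m : ℤ, φ x = m) →
      ∃ v ∈ F, ∃ v' ∈ F, 4 * (n : ℝ) ^ 4 ≤ φ v - φ v') :
    ∃ z ∈ L, z ∈ convexHull ℝ (F : Set V) := by
  classical
  obtain ⟨b, hbG, hb⟩ := exists_basis_abs_repr_le_one hV (F.image fun v => v - v₀)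
    (by simpa using hspan)
  have hn' : (0 : ℝ) < n := by exact_mod_cast hn
  let T : V ≃ₗ[ℝ] EuclideanSpace ℝ (Fin n) :=
    b.equivFun ≪≫ₗ (WithLp.linearEquiv 2 ℝ (Fin n → ℝ)).symm
  have hT : ∀ v i, T v i = b.repr v i := fun v i => rfl
  have hTF : ∀ v ∈ F, ∀ i, |T v i - T v₀ i| ≤ 1 := by
    intro v hv i
    have := hb (v - v₀) (Finset.mem_image_of_mem _ hv) i
    simpa [hT] using this
  let c : EuclideanSpace ℝ (Fin n) := T v₀ + WithLp.toLp 2 (fun _ => 1 / (2 * (n : ℝ)))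
  obtain ⟨_, ⟨z, hz, rfl⟩, hcz⟩ := exists_mem_lattice_norm_sub_le n (EuclideanSpace ℝ (Fin n))
    (by simp) _ (hL.map_linearEquiv T) (2 * (n : ℝ) ^ 3) (by positivity) (by
      intro y hy hyL
      let φ : V →ₗ[ℝ] ℝ := (innerₛₗ ℝ y) ∘ₗ T.toLinearMap
      have hφ : ∀ v, φ v = inner ℝ y (T v) := fun v => rfl
      obtain ⟨v, hv, v', hv', hvv⟩ := hwidth φ (by
        intro h0
        have := hφ (T.symm y)
        rw [h0, T.apply_symm_apply] at this
        exact hy (inner_self_eq_zero.1 this.symm)) (fun x hx => hyL (T x) ⟨x, hx, rfl⟩)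
      have h1 : φ v - φ v' = ∑ i, y i * (T v i - T v' i) := by
        rw [hφ, hφ, ← inner_sub_right, PiLp.inner_apply]
        simp [mul_comm]
      have h2 : ∑ i, y i * (T v i - T v' i) ≤ ∑ _i : Fin n, ‖y‖ * 2 := by
        refine Finset.sum_le_sum fun i _ => ?_
        refine (le_abs_self _).trans ?_
        rw [abs_mul]
        have h3 := abs_le.1 (hTF v hv i)
        have h4 := abs_le.1 (hTF v' hv' i)
        refine mul_le_mul (PiLp.norm_apply_le y i) ?_ (abs_nonneg _) (norm_nonneg _)
        rw [abs_le]
        constructor <;> linarith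
      rw [h1] at hvv
      have h5 := hvv.trans h2
      simp only [Finset.sum_const, Finset.card_univ, Fintype.card_fin, nsmul_eq_mul] at h5
      have : (2 * (n : ℝ)) * (2 * (n : ℝ) ^ 3) ≤ (2 * n) * ‖y‖ := by nlinarith
      exact le_of_mul_le_mul_left this (by positivity)) c
  refine ⟨z, hz, ?_⟩
  have ha : ∀ i, 0 ≤ b.repr (z - v₀) i ∧ n * b.repr (z - v₀) i ≤ 1 := by
    intro i
    have h1 : |c i - T z i| ≤ 1 / (2 * (n : ℝ)) := by
      refine (PiLp.norm_apply_le (c - T z) i).trans (hcz.trans (le_of_eq ?_))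
      field_simp
    have h2 : c i = T v₀ i + 1 / (2 * (n : ℝ)) := rfl
    have h3 : b.repr (z - v₀) i = T z i - T v₀ i := by simp [hT]
    rw [h2] at h1
    obtain ⟨h4, h5⟩ := abs_le.1 h1
    rw [h3]
    refine ⟨by linarith, ?_⟩
    have h6 : T z i - T v₀ i ≤ 1 / n := by
      have : (1 : ℝ) / n = 1 / (2 * n) + 1 / (2 * n) := by field_simp; norm_num
      linarith
    calc _ ≤ (n : ℝ) * (1 / n) := by gcongr
      _ = 1 := by field_simp
  have hz' : z = ∑ i : Fin n, (1 / (n : ℝ)) • (v₀ + (n * b.repr (z - v₀) i) • b i) := by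
    have h1 := b.sum_repr (z - v₀)
    simp only [smul_add, Finset.sum_add_distrib, Finset.sum_const, Finset.card_univ,
      Fintype.card_fin, smul_smul]
    have h2 : ∀ i, 1 / (n : ℝ) * (n * b.repr (z - v₀) i) = b.repr (z - v₀) i := fun i => by
      field_simp
    simp only [h2, h1]
    rw [← Nat.cast_smul_eq_nsmul ℝ, smul_smul, mul_one_div_cancel hn'.ne', one_smul]
    abel
  rw [hz']
  refine (convex_convexHull ℝ _).sum_mem (fun _ _ => by positivity) (by simp [hn'.ne'])
    fun i _ => ?_
  obtain ⟨v, hv, hvb⟩ := Finset.mem_image.1 (hbG i)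
  have h1 : v₀ + b i ∈ convexHull ℝ (F : Set V) := by
    rw [← hvb, add_sub_cancel]
    exact subset_convexHull ℝ _ hv
  exact (convex_convexHull ℝ _).add_smul_mem (subset_convexHull ℝ _ hv₀) h1
    ⟨mul_nonneg hn'.le (ha i).1, (ha i).2⟩

theorem finite_setOf_eq_intCast_abs_le (C : ℝ) : {x : ℝ | (∃ m : ℤ, x = m) ∧ |x| ≤ C}.Finite := by
  refine ((Set.finite_Icc (-⌊C⌋) ⌊C⌋).image (fun m : ℤ => (m : ℝ))).subset ?_
  rintro _ ⟨⟨m, rfl⟩, hm⟩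
  refine ⟨m, ?_, rfl⟩
  rw [← Int.cast_abs] at hm
  exact abs_le.1 (Int.le_floor.2 hm)

theorem le_add_mul_sub_of_lattice_width {E : Type*} [AddCommGroup E] [Module ℝ E] {V : Type}
    [NormedAddCommGroup V] [NormedSpace ℝ V] [FiniteDimensional ℝ V] {n : ℕ} (hn : 0 < n)
    (hV : Module.finrank ℝ V = n) (L : Submodule ℤ V) (hL : FiniteInBalls L) (σ : E →ᵃ[ℝ] V)
    {Q : Set E} (hQ : Convex ℝ Q) {δ : ℝ} (hδ : 0 < δ) (hδ1 : δ ≤ 1) (F : Finset E)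
    (hFQ : ∀ x ∈ F, x ∈ Q) {p : E} (hp : p ∈ F)
    (hspan : Submodule.span ℝ ((fun v => σ v - σ p) '' (F : Set E)) = ⊤)
    (hwidth : ∀ φ : V →ₗ[ℝ] ℝ, φ ≠ 0 → (∀ x ∈ L, ∃ m : ℤ, φ x = m) →
      ∃ v ∈ F, ∃ v' ∈ F, 12 * (n : ℝ) ^ 4 / δ ≤ φ (σ v) - φ (σ v'))
    (h : E →ₗ[ℝ] ℝ) {a b : ℝ} (hab : ∀ x ∈ Q, σ x ∈ L → a ≤ h x ∧ h x ≤ b) :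
    h p ≤ b + δ * (b - a) := by
  classical
  have key : ∀ u ∈ F, ∃ q ∈ convexHull ℝ (F : Set E),
      AffineMap.homothety u (δ / 3) q ∈ Q ∧ σ (AffineMap.homothety u (δ / 3) q) ∈ L := by
    intro u hu
    let g : E →ᵃ[ℝ] V := σ.comp (AffineMap.homothety u (δ / 3))
    have hg : ∀ v v', g v - g v' = (δ / 3) • (σ v - σ v') := by
      intro v v'
      have h1 : g v - g v' = g.linear (v - v') := by simpa using (g.linearMap_vsub v v').symm
      have h2 : σ v - σ v' = σ.linear (v - v') := by simpa using (σ.linearMap_vsub v v').symm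
      rw [h1, h2]
      simp [g]
    obtain ⟨z, hzL, hz⟩ := exists_lattice_mem_convexHull hn hV L hL (F.image g) (g p)
      (Finset.mem_image_of_mem _ hp) (by
        rw [Finset.coe_image, Set.image_image]
        simp only [hg]
        rw [← Set.image_image (fun v => (δ / 3) • v) (fun v => σ v - σ p), Set.image_smul,
          Submodule.span_smul_eq_of_isUnit _ _ (isUnit_iff_ne_zero.2 (by positivity)), hspan])
      (fun φ hφ hφL => by
        obtain ⟨v, hv, v', hv', hvv⟩ := hwidth φ hφ hφL
        refine ⟨g v, Finset.mem_image_of_mem _ hv, g v', Finset.mem_image_of_mem _ hv', ?_⟩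
        rw [← map_sub, hg, map_smul, map_sub, smul_eq_mul]
        rw [div_le_iff₀ hδ] at hvv
        linarith)
    rw [Finset.coe_image, ← AffineMap.image_convexHull] at hz
    obtain ⟨q, hq, rfl⟩ := hz
    refine ⟨q, hq, ?_, hzL⟩
    have hqQ : q ∈ Q := convexHull_min hFQ hQ hq
    rw [AffineMap.homothety_eq_lineMap]
    exact hQ.lineMap_mem (hFQ u hu) hqQ ⟨by positivity, by linarith⟩
  obtain ⟨u, hu, humax⟩ := F.exists_max_image h ⟨p, hp⟩
  obtain ⟨u', hu', humin⟩ := F.exists_min_image h ⟨p, hp⟩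
  have hhull : ∀ q ∈ convexHull ℝ (F : Set E), h u' ≤ h q ∧ h q ≤ h u := by
    intro q hq
    have h1 : convexHull ℝ (F : Set E) ⊆ {x | h u' ≤ h x} :=
      convexHull_min humin (convex_halfSpace_ge h.isLinear _)
    have h2 : convexHull ℝ (F : Set E) ⊆ {x | h x ≤ h u} :=
      convexHull_min humax (convex_halfSpace_le h.isLinear _)
    exact ⟨h1 hq, h2 hq⟩
  obtain ⟨q, hq, hqQ, hqL⟩ := key u hu
  obtain ⟨q', hq', hqQ', hqL'⟩ := key u' hu'
  have h1 := (hab _ hqQ hqL).2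
  have h2 := (hab _ hqQ' hqL').1
  have h3 := (hhull q hq).1
  have h4 := (hhull q' hq').2
  simp only [AffineMap.homothety_apply, vsub_eq_sub, vadd_eq_add, map_add, map_smul, map_sub,
    smul_eq_mul] at h1 h2
  have h5 := humax p hp
  have h6 : 0 ≤ h u - h u' := by linarith [humin u hu]
  have h7 : δ / 3 * (h u' - h u) ≤ δ / 3 * (h q - h u) := by gcongr
  have h8 : δ / 3 * (h q' - h u') ≤ δ / 3 * (h u - h u') := by gcongr
  have h9 : (h u - h u') * (1 - 2 * (δ / 3)) ≤ b - a := by nlinarith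
  have h10 : (h u - h u') * (1 / 3) ≤ b - a := by nlinarith
  nlinarith

theorem exists_finset_lattice_width {E : Type*} [AddCommGroup E] [Module ℝ E] {V : Type*}
    [AddCommGroup V] [Module ℝ V] [FiniteDimensional ℝ V] (L : Submodule ℤ V)
    (hLspan : Submodule.span ℝ (L : Set V) = ⊤) (σ : E →ᵃ[ℝ] V) {Q : Set E} {p : E} (hp : p ∈ Q)
    (hspan : Submodule.span ℝ ((fun v => σ v - σ p) '' Q) = ⊤) (w : ℝ)
    (hwidth : ∀ φ : V →ₗ[ℝ] ℝ, φ ≠ 0 → (∀ x ∈ L, ∃ m : ℤ, φ x = m) →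
      ∃ v ∈ Q, ∃ v' ∈ Q, w ≤ φ (σ v) - φ (σ v')) :
    ∃ F : Finset E, (∀ x ∈ F, x ∈ Q) ∧ p ∈ F ∧
      Submodule.span ℝ ((fun v => σ v - σ p) '' (F : Set E)) = ⊤ ∧
      ∀ φ : V →ₗ[ℝ] ℝ, φ ≠ 0 → (∀ x ∈ L, ∃ m : ℤ, φ x = m) →
        ∃ v ∈ F, ∃ v' ∈ F, w ≤ φ (σ v) - φ (σ v') := by
  classical
  obtain ⟨f, hfQ, hfspan, -⟩ :=
    Submodule.exists_fun_fin_finrank_span_eq ℝ ((fun v => σ v - σ p) '' Q)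
  replace hfspan := hfspan.trans hspan
  choose q hqQ hq using hfQ
  obtain ⟨e, heL, hespan, -⟩ := Submodule.exists_fun_fin_finrank_span_eq ℝ (L : Set V)
  replace hespan := hespan.trans hLspan
  let F₀ : Finset E := insert p (Finset.univ.image q)
  have hpF : p ∈ F₀ := Finset.mem_insert_self _ _
  have hqF : ∀ i, q i ∈ F₀ := fun i =>
    Finset.mem_insert_of_mem (Finset.mem_image_of_mem _ (Finset.mem_univ i))
  have hF₀ : ∀ x ∈ F₀, x ∈ Q := by
    intro x hx
    rcases Finset.mem_insert.1 hx with rfl | hx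
    · exact hp
    · obtain ⟨i, -, rfl⟩ := Finset.mem_image.1 hx
      exact hqQ i
  let Φ : Set (V →ₗ[ℝ] ℝ) := {φ | (∀ x ∈ L, ∃ m : ℤ, φ x = m) ∧
    ∀ v ∈ F₀, ∀ v' ∈ F₀, φ (σ v) - φ (σ v') ≤ w}
  have hbdd : ∀ x : V, ∃ C : ℝ, ∀ φ ∈ Φ, |φ x| ≤ C := by
    intro x
    have hx : x ∈ Submodule.span ℝ (Set.range f) := hfspan ▸ Submodule.mem_top
    induction hx using Submodule.span_induction with
    | mem x hx =>
      obtain ⟨i, rfl⟩ := hx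
      refine ⟨w, fun φ hφ => ?_⟩
      rw [← hq i, map_sub, abs_sub_le_iff]
      exact ⟨hφ.2 _ (hqF i) _ hpF, hφ.2 _ hpF _ (hqF i)⟩
    | zero => exact ⟨0, fun φ _ => by simp⟩
    | add x y _ _ hx hy =>
      obtain ⟨C, hC⟩ := hx
      obtain ⟨D, hD⟩ := hy
      refine ⟨C + D, fun φ hφ => ?_⟩
      rw [map_add]
      exact (abs_add_le _ _).trans (add_le_add (hC φ hφ) (hD φ hφ))
    | smul t x _ hx =>
      obtain ⟨C, hC⟩ := hx
      refine ⟨|t| * C, fun φ hφ => ?_⟩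
      rw [map_smul, smul_eq_mul, abs_mul]
      exact mul_le_mul_of_nonneg_left (hC φ hφ) (abs_nonneg t)
  choose C hC using hbdd
  have hΦ : Φ.Finite := by
    refine Set.Finite.of_finite_image (f := fun φ i => φ (e i))
      ((Set.Finite.pi' fun i => finite_setOf_eq_intCast_abs_le (C (e i))).subset ?_) ?_
    · rintro _ ⟨φ, hφ, rfl⟩ i
      exact ⟨hφ.1 _ (heL i), hC _ φ hφ⟩
    · intro φ _ φ' _ hφφ
      refine LinearMap.ext_on_range hespan fun i => congrFun hφφ i
  have hchoice : ∀ φ : V →ₗ[ℝ] ℝ, ∃ v ∈ Q, ∃ v' ∈ Q, φ ≠ 0 → (∀ x ∈ L, ∃ m : ℤ, φ x = m) →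
      w ≤ φ (σ v) - φ (σ v') := by
    intro φ
    by_cases h : φ ≠ 0 ∧ ∀ x ∈ L, ∃ m : ℤ, φ x = m
    · obtain ⟨v, hv, v', hv', hvv⟩ := hwidth φ h.1 h.2
      exact ⟨v, hv, v', hv', fun _ _ => hvv⟩
    · exact ⟨p, hp, p, hp, fun h1 h2 => (h ⟨h1, h2⟩).elim⟩
  choose c hcQ c' hcQ' hc using hchoice
  refine ⟨F₀ ∪ hΦ.toFinset.image c ∪ hΦ.toFinset.image c', ?_, ?_, ?_, ?_⟩
  · intro x hx
    simp only [Finset.mem_union, Finset.mem_image] at hx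
    rcases hx with (hx | ⟨φ, -, rfl⟩) | ⟨φ, -, rfl⟩
    · exact hF₀ x hx
    · exact hcQ φ
    · exact hcQ' φ
  · simp [hpF]
  · rw [eq_top_iff, ← hfspan]
    refine Submodule.span_mono ?_
    rintro _ ⟨i, rfl⟩
    exact ⟨q i, by simp [hqF i], hq i⟩
  · intro φ hφ0 hφL
    by_cases hφ : φ ∈ Φ
    · refine ⟨c φ, ?_, c' φ, ?_, hc φ hφ0 hφL⟩
      · exact Finset.mem_union_left _ (Finset.mem_union_right _
          (Finset.mem_image_of_mem _ (hΦ.mem_toFinset.2 hφ)))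
      · exact Finset.mem_union_right _ (Finset.mem_image_of_mem _ (hΦ.mem_toFinset.2 hφ))
    · have : ∃ v ∈ F₀, ∃ v' ∈ F₀, w < φ (σ v) - φ (σ v') := by
        by_contra! hcon
        exact hφ ⟨hφL, hcon⟩
      obtain ⟨v, hv, v', hv', hvv⟩ := this
      exact ⟨v, by simp [hv], v', by simp [hv'], hvv.le⟩

/-- The points of a convex set `Q` that `σ` maps into a lattice of rank `n` are covered by at most
`M ^ n` affine subspaces whose intersections with `Q` stay `δ`-close to those points. -/
theorem exists_affineSubspaces_cover {E : Type*} [AddCommGroup E] [Module ℝ E] {δ : ℝ}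
    (hδ : 0 < δ) (hδ1 : δ ≤ 1) (k M : ℕ) (hM : 2 * (12 * (k : ℝ) ^ 4 / δ) + 1 ≤ M) (n : ℕ) :
    n ≤ k → ∀ (V : Type) [NormedAddCommGroup V] [NormedSpace ℝ V] [FiniteDimensional ℝ V],
    Module.finrank ℝ V = n → ∀ L : Submodule ℤ V, FiniteInBalls L → ∀ (σ : E →ᵃ[ℝ] V) (Q : Set E),
    Convex ℝ Q → ∃ 𝒮 : Finset (AffineSubspace ℝ E), 𝒮.card ≤ M ^ n ∧
      (∀ x ∈ Q, σ x ∈ L → ∃ S ∈ 𝒮, x ∈ S) ∧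
      ∀ S ∈ 𝒮, ∀ (h : E →ₗ[ℝ] ℝ) (a b : ℝ), (∀ x ∈ Q, σ x ∈ L → a ≤ h x ∧ h x ≤ b) →
        ∀ p ∈ Q, p ∈ S → h p ≤ b + δ * (b - a) := by
  classical
  induction n with
  | zero =>
    intro _ V _ _ _ hV L _ σ Q _
    have := Module.finrank_zero_iff.1 hV
    refine ⟨{⊤}, by simp, fun x _ _ => ⟨⊤, by simp⟩, fun S _ h a b hab p hp _ => ?_⟩
    have := hab p hp (by rw [Subsingleton.elim (σ p) 0]; exact L.zero_mem)
    nlinarith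
  | succ n ih =>
    intro hnk V _ _ _ hV L hL σ Q hQ
    have hnk' : ((n + 1 : ℕ) : ℝ) ≤ k := by exact_mod_cast hnk
    have hM1 : 1 ≤ M := by
      have : (1 : ℝ) ≤ M := le_trans (by have : 0 ≤ 12 * (k : ℝ) ^ 4 / δ := by positivity
                                         linarith) hM
      exact_mod_cast this
    by_cases hslice : ∃ ψ : V →ₗ[ℝ] ℝ, ψ ≠ 0 ∧ ∃ J : Finset ℝ, J.card ≤ M ∧
        ∀ x ∈ Q, σ x ∈ L → ψ (σ x) ∈ J
    · obtain ⟨ψ, hψ, J, hJM, hJ⟩ := hslice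
      have hker : Module.finrank ℝ (LinearMap.ker ψ) = n := by
        have := Module.Dual.finrank_ker_add_one_of_ne_zero hψ
        omega
      obtain ⟨g, hg⟩ := (LinearMap.ker ψ).subtype.exists_leftInverse_of_injective
        (Submodule.ker_subtype _)
      have hg' : ∀ u : LinearMap.ker ψ, g u = u := fun u => LinearMap.congr_fun hg u
      have hj : ∀ j : ℝ, ∃ 𝒮 : Finset (AffineSubspace ℝ E), 𝒮.card ≤ M ^ n ∧
          (∀ x ∈ Q, σ x ∈ L → ψ (σ x) = j → ∃ S ∈ 𝒮, x ∈ S) ∧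
          ∀ S ∈ 𝒮, ∀ (h : E →ₗ[ℝ] ℝ) (a b : ℝ), (∀ x ∈ Q, σ x ∈ L → a ≤ h x ∧ h x ≤ b) →
            ∀ p ∈ Q, p ∈ S → h p ≤ b + δ * (b - a) := by
        intro j
        by_cases hx₀ : ∃ x₀ ∈ Q, σ x₀ ∈ L ∧ ψ (σ x₀) = j
        · obtain ⟨x₀, hx₀Q, hx₀L, hx₀j⟩ := hx₀
          let S₀ : AffineSubspace ℝ E := (AffineSubspace.mk' (σ x₀) (LinearMap.ker ψ)).comap σ
          have hS₀ : ∀ x, x ∈ S₀ ↔ ψ (σ x) = j := by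
            intro x
            simp [S₀, AffineSubspace.mem_mk', sub_eq_zero, hx₀j]
          let σ' : E →ᵃ[ℝ] LinearMap.ker ψ :=
            g.toAffineMap.comp (σ - AffineMap.const ℝ E (σ x₀))
          let L' : Submodule ℤ (LinearMap.ker ψ) :=
            L.comap ((LinearMap.ker ψ).subtype.restrictScalars ℤ)
          have hσ' : ∀ x, ψ (σ x) = j → (σ' x ∈ L' ↔ σ x ∈ L) := by
            intro x hx
            have h1 : σ x - σ x₀ ∈ LinearMap.ker ψ := by simp [hx, hx₀j]
            have h2 : ((σ' x : LinearMap.ker ψ) : V) = σ x - σ x₀ :=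
              congrArg Subtype.val (hg' ⟨_, h1⟩)
            change ((σ' x : LinearMap.ker ψ) : V) ∈ L ↔ _
            rw [h2]
            exact L.sub_mem_iff_left hx₀L
          have hL' : FiniteInBalls L' := by
            intro r
            refine Set.Finite.of_finite_image ((hL r).subset ?_) Subtype.val_injective.injOn
            rintro _ ⟨u, hu, rfl⟩
            exact hu
          obtain ⟨𝒮, hcard, hcover, hbound⟩ := ih (by omega) (LinearMap.ker ψ) hker L' hL' σ'
            (Q ∩ S₀) (hQ.inter S₀.convex)
          refine ⟨𝒮.image (S₀ ⊓ ·), Finset.card_image_le.trans hcard, ?_, ?_⟩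
          · intro x hx hxL hxj
            obtain ⟨S, hS, hxS⟩ := hcover x ⟨hx, (hS₀ x).2 hxj⟩ ((hσ' x hxj).2 hxL)
            exact ⟨S₀ ⊓ S, Finset.mem_image_of_mem _ hS, (hS₀ x).2 hxj, hxS⟩
          · intro S hS h a b hab p hp hpS
            obtain ⟨T, hT, rfl⟩ := Finset.mem_image.1 hS
            exact hbound T hT h a b
              (fun x hx hxL => hab x hx.1 ((hσ' x ((hS₀ x).1 hx.2)).1 hxL)) p ⟨hp, hpS.1⟩ hpS.2
        · exact ⟨∅, by simp, fun x hx hxL hxj => (hx₀ ⟨x, hx, hxL, hxj⟩).elim, by simp⟩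
      choose 𝒮 hcard hcover hbound using hj
      refine ⟨J.biUnion 𝒮, ?_, ?_, ?_⟩
      · refine Finset.card_biUnion_le.trans ((Finset.sum_le_sum fun j _ => hcard j).trans ?_)
        rw [Finset.sum_const, smul_eq_mul, pow_succ']
        exact Nat.mul_le_mul_right _ hJM
      · intro x hx hxL
        obtain ⟨S, hS, hxS⟩ := hcover _ x hx hxL rfl
        exact ⟨S, Finset.mem_biUnion.2 ⟨_, hJ x hx hxL, hS⟩, hxS⟩
      · intro S hS
        obtain ⟨j, -, hS⟩ := Finset.mem_biUnion.1 hS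
        exact hbound j S hS
    · refine ⟨{⊤}, by simpa using Nat.one_le_pow _ _ hM1, fun x _ _ => ⟨⊤, by simp⟩, ?_⟩
      intro _ _ h a b hab p hp _
      push Not at hslice
      have hLspan : Submodule.span ℝ (L : Set V) = ⊤ := by
        by_contra hne
        obtain ⟨ψ, hψ, hker⟩ := Submodule.exists_le_ker_of_lt_top _ (lt_top_iff_ne_top.2 hne)
        obtain ⟨x, _, hxL, hx⟩ := hslice ψ hψ {0} (by simpa using hM1)
        exact hx (by simpa using hker (Submodule.subset_span hxL))
      have hspan : Submodule.span ℝ ((fun v => σ v - σ p) '' Q) = ⊤ := by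
        by_contra hne
        obtain ⟨ψ, hψ, hker⟩ := Submodule.exists_le_ker_of_lt_top _ (lt_top_iff_ne_top.2 hne)
        obtain ⟨x, hxQ, _, hx⟩ := hslice ψ hψ {ψ (σ p)} (by simpa using hM1)
        refine hx ?_
        have : σ x - σ p ∈ LinearMap.ker ψ := hker (Submodule.subset_span ⟨x, hxQ, rfl⟩)
        simpa [sub_eq_zero] using this
      set w : ℝ := 12 * ((n + 1 : ℕ) : ℝ) ^ 4 / δ with hw
      have hwk : w ≤ 12 * (k : ℝ) ^ 4 / δ := by rw [hw]; gcongr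
      have hw0 : 0 ≤ w := by positivity
      have hwidth : ∀ φ : V →ₗ[ℝ] ℝ, φ ≠ 0 → (∀ x ∈ L, ∃ m : ℤ, φ x = m) →
          ∃ v ∈ Q, ∃ v' ∈ Q, w ≤ φ (σ v) - φ (σ v') := by
        intro φ hφ hφL
        by_contra! hcon
        by_cases hx₀ : ∃ x₀ ∈ Q, σ x₀ ∈ L
        · obtain ⟨x₀, hx₀Q, hx₀L⟩ := hx₀
          obtain ⟨m₀, hm₀⟩ := hφL _ hx₀L
          obtain ⟨x, hxQ, hxL, hx⟩ := hslice φ hφ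
            ((Finset.Icc (m₀ - ⌊w⌋) (m₀ + ⌊w⌋)).image (fun m : ℤ => (m : ℝ))) (by
              refine Finset.card_image_le.trans ?_
              rw [Int.card_Icc, Int.toNat_le]
              have h1 : (⌊w⌋ : ℝ) ≤ w := Int.floor_le w
              have h2 : ((m₀ + ⌊w⌋ + 1 - (m₀ - ⌊w⌋) : ℤ) : ℝ) ≤ ((M : ℤ) : ℝ) := by
                push_cast
                linarith
              exact_mod_cast h2)
          obtain ⟨m, hm⟩ := hφL _ hxL
          refine hx (Finset.mem_image.2 ⟨m, ?_, hm.symm⟩)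
          have h1 := hcon x hxQ x₀ hx₀Q
          have h2 := hcon x₀ hx₀Q x hxQ
          rw [hm, hm₀] at h1 h2
          have h3 : m - m₀ ≤ ⌊w⌋ := Int.le_floor.2 (by push_cast; exact h1.le)
          have h4 : m₀ - m ≤ ⌊w⌋ := Int.le_floor.2 (by push_cast; exact h2.le)
          rw [Finset.mem_Icc]
          omega
        · obtain ⟨x, hxQ, hxL, _⟩ := hslice φ hφ ∅ (by simp)
          exact hx₀ ⟨x, hxQ, hxL⟩
      obtain ⟨F, hFQ, hpF, hFspan, hFwidth⟩ :=
        exists_finset_lattice_width L hLspan σ hp hspan w hwidth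
      exact le_add_mul_sub_of_lattice_width (Nat.succ_pos n) hV L hL σ hQ hδ hδ1 F hFQ hpF hFspan
        hFwidth h hab

theorem relDist_le_add {ι : Type*} {C B D : Set (ι → ℝ)} (hC : Convex ℝ C) {ε δ : ℝ}
    (hε : 0 ≤ ε) (hε1 : ε ≤ 1) (hδ : 0 < δ) (hCB : relDist C B ≤ ENNReal.ofReal ε)
    (hD : ∀ (g : (ι → ℝ) →ₗ[ℝ] ℝ) (a b : ℝ), (∀ x ∈ B, a ≤ g x ∧ g x ≤ b) →
      ∀ y ∈ D, g y ≤ b + δ / 3 * (b - a)) :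
    relDist C D ≤ ENNReal.ofReal (ε + δ) := by
  refine iSup_le fun g => ENNReal.div_le_of_le_mul ?_
  have hg := (le_iSup (fun π : (ι → ℝ) →ₗ[ℝ] ℝ =>
    (⨆ b ∈ B, ⨅ a ∈ C, ENNReal.ofReal |π b - π a|) /
      (⨆ a ∈ C, ⨆ a' ∈ C, ENNReal.ofReal |π a - π a'|)) g).trans hCB
  rcases C.eq_empty_or_nonempty with rfl | ⟨c₀, hc₀⟩
  · have hB : B = ∅ := by
      by_contra hne
      obtain ⟨x, hx⟩ := Set.nonempty_iff_ne_empty.2 hne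
      have h1 : (⊤ : ℝ≥0∞) ≤ ⨆ b ∈ B, ⨅ a ∈ (∅ : Set (ι → ℝ)), ENNReal.ofReal |g b - g a| := by
        refine le_trans ?_ (le_iSup₂ x hx)
        simp
      rw [top_le_iff.1 h1] at hg
      have h2 : (⨆ a ∈ (∅ : Set (ι → ℝ)), ⨆ a' ∈ (∅ : Set (ι → ℝ)),
          ENNReal.ofReal |g a - g a'|) = 0 := by simp
      rw [h2, ENNReal.div_zero ENNReal.top_ne_zero, top_le_iff] at hg
      exact ENNReal.ofReal_ne_top hg
    have hDe : D = ∅ := by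
      by_contra hne
      obtain ⟨y, hy⟩ := Set.nonempty_iff_ne_empty.2 hne
      have := hD 0 (-1) (-1) (by simp [hB]) y hy
      norm_num at this
    simp [hDe]
  set den := ⨆ a ∈ C, ⨆ a' ∈ C, ENNReal.ofReal |g a - g a'| with hden
  by_cases htop : den = ⊤
  · rw [htop, ENNReal.mul_top (ENNReal.ofReal_pos.2 (by linarith)).ne']
    exact le_top
  rw [ENNReal.div_le_iff_le_mul (Or.inr ENNReal.ofReal_ne_top) (Or.inl htop)] at hg
  set Δ := den.toReal with hΔ
  have hΔ0 : 0 ≤ Δ := ENNReal.toReal_nonneg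
  have hdenΔ : den = ENNReal.ofReal Δ := (ENNReal.ofReal_toReal htop).symm
  have hdiam : ∀ c ∈ C, ∀ c' ∈ C, |g c - g c'| ≤ Δ := by
    intro c hc c' hc'
    rw [← ENNReal.ofReal_le_ofReal_iff hΔ0, ← hdenΔ, hden]
    exact (le_iSup₂ (f := fun a' _ => ENNReal.ofReal |g c - g a'|) c' hc').trans
      (le_iSup₂ (f := fun a _ => ⨆ a' ∈ C, ENNReal.ofReal |g a - g a'|) c hc)
  set α := sInf (g '' C) with hα
  set β := sSup (g '' C) with hβ
  have hne : (g '' C).Nonempty := ⟨_, c₀, hc₀, rfl⟩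
  have hbddA : BddAbove (g '' C) := by
    refine ⟨g c₀ + Δ, ?_⟩
    rintro _ ⟨c, hc, rfl⟩
    linarith [(abs_le.1 (hdiam c hc c₀ hc₀)).2]
  have hbddB : BddBelow (g '' C) := by
    refine ⟨g c₀ - Δ, ?_⟩
    rintro _ ⟨c, hc, rfl⟩
    linarith [(abs_le.1 (hdiam c hc c₀ hc₀)).1]
  have hCαβ : ∀ c ∈ C, α ≤ g c ∧ g c ≤ β := fun c hc =>
    ⟨csInf_le hbddB ⟨c, hc, rfl⟩, le_csSup hbddA ⟨c, hc, rfl⟩⟩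
  have hβα : β - α ≤ Δ := by
    have : β - Δ ≤ α := by
      refine le_csInf hne ?_
      rintro _ ⟨c, hc, rfl⟩
      have : β ≤ g c + Δ := by
        refine csSup_le hne ?_
        rintro _ ⟨c', hc', rfl⟩
        linarith [(abs_le.1 (hdiam c' hc' c hc)).2]
      linarith
    linarith
  have hBαβ : ∀ x ∈ B, α - ε * Δ ≤ g x ∧ g x ≤ β + ε * Δ := by
    intro x hx
    have h1 : ⨅ a ∈ C, ENNReal.ofReal |g x - g a| ≤ ENNReal.ofReal (ε * Δ) := by
      rw [ENNReal.ofReal_mul hε, ← hdenΔ]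
      exact (le_iSup₂ (f := fun b _ => ⨅ a ∈ C, ENNReal.ofReal |g b - g a|) x hx).trans hg
    have h2 : ∀ η : ℝ, 0 < η → ∃ c ∈ C, |g x - g c| ≤ ε * Δ + η := by
      intro η hη
      have h3 := h1.trans_lt ((ENNReal.ofReal_lt_ofReal_iff (by positivity)).2
        (by linarith : ε * Δ < ε * Δ + η))
      simp only [iInf_lt_iff] at h3
      obtain ⟨c, hc, hlt⟩ := h3
      exact ⟨c, hc, ((ENNReal.ofReal_lt_ofReal_iff (by positivity)).1 hlt).le⟩
    constructor
    · refine le_of_forall_pos_le_add fun η hη => ?_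
      obtain ⟨c, hc, h3⟩ := h2 η hη
      linarith [(abs_le.1 h3).1, (hCαβ c hc).1]
    · refine le_of_forall_pos_le_add fun η hη => ?_
      obtain ⟨c, hc, h3⟩ := h2 η hη
      linarith [(abs_le.1 h3).2, (hCαβ c hc).2]
  have hslack : ε * Δ + δ / 3 * (β - α + 2 * (ε * Δ)) ≤ (ε + δ) * Δ := by
    have : ε * Δ ≤ Δ := mul_le_of_le_one_left hΔ0 hε1
    nlinarith
  refine iSup₂_le fun y hy => ?_
  rw [hdenΔ, ← ENNReal.ofReal_mul (by positivity)]
  have hup : g y ≤ β + (ε + δ) * Δ := by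
    have := hD g _ _ hBαβ y hy
    linarith
  have hlow : α - (ε + δ) * Δ ≤ g y := by
    have := hD (-g) (-(β + ε * Δ)) (-(α - ε * Δ)) (fun x hx => by
      have := hBαβ x hx
      simp only [LinearMap.neg_apply]
      constructor <;> linarith) y hy
    simp only [LinearMap.neg_apply] at this
    linarith
  have hKΔ : 0 ≤ (ε + δ) * Δ := by positivity
  have hnear : ∀ η : ℝ, 0 < η → ∃ c ∈ C, |g y - g c| ≤ (ε + δ) * Δ + η := by
    intro η hη
    obtain ⟨_, ⟨c₁, hc₁, rfl⟩, h1⟩ := exists_lt_of_lt_csSup hne (by linarith : β - η < β)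
    obtain ⟨_, ⟨c₂, hc₂, rfl⟩, h2⟩ := exists_lt_of_csInf_lt hne (by linarith : α < α + η)
    by_cases h3 : g c₁ ≤ g y
    · exact ⟨c₁, hc₁, abs_le.2 ⟨by linarith, by linarith⟩⟩
    by_cases h4 : g y ≤ g c₂
    · exact ⟨c₂, hc₂, abs_le.2 ⟨by linarith, by linarith⟩⟩
    push Not at h3 h4
    obtain ⟨c, hc, hcy⟩ := (hC.is_linear_image g.isLinear).ordConnected.out ⟨c₂, hc₂, rfl⟩
      ⟨c₁, hc₁, rfl⟩ ⟨h4.le, h3.le⟩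
    exact ⟨c, hc, by rw [hcy, sub_self, abs_zero]; linarith⟩
  refine ENNReal.le_of_forall_pos_le_add fun η hη _ => ?_
  obtain ⟨c, hc, h1⟩ := hnear η hη
  refine (iInf₂_le c hc).trans ((ENNReal.ofReal_le_ofReal h1).trans ?_)
  rw [ENNReal.ofReal_add hKΔ η.coe_nonneg, ENNReal.ofReal_coe_nnreal]

theorem IsPolyhedronOfSize.convex {ι : Type*} {Q : Set (ι → ℝ)} {m : ℕ}
    (hQ : IsPolyhedronOfSize Q m) : Convex ℝ Q := by
  obtain ⟨S, nh, -, f, b, rfl⟩ := hQ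
  refine S.convex.inter ?_
  rw [Set.ofPred_forall]
  exact convex_iInter fun i => convex_halfSpace_le (f i).isLinear _

theorem IsPolyhedronOfSize.preimage {ι κ : Type*} {Q : Set (ι → ℝ)} {m : ℕ}
    (hQ : IsPolyhedronOfSize Q m) (T : (κ → ℝ) →ₗ[ℝ] (ι → ℝ)) :
    IsPolyhedronOfSize (T ⁻¹' Q) m := by
  obtain ⟨S, nh, hnh, f, b, rfl⟩ := hQ
  exact ⟨S.comap T.toAffineMap, nh, hnh, fun i => f i ∘ₗ T, b, rfl⟩

theorem isPolyhedronOfSize_of_fintype {ι κ : Type*} [Fintype κ] (S : AffineSubspace ℝ (ι → ℝ))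
    (f : κ → (ι → ℝ) →ₗ[ℝ] ℝ) (b : κ → ℝ) :
    IsPolyhedronOfSize ((S : Set (ι → ℝ)) ∩ {x | ∀ i, f i x ≤ b i}) (Fintype.card κ) := by
  let e := Fintype.equivFin κ
  refine ⟨S, Fintype.card κ, le_rfl, fun i => f (e.symm i), fun i => b (e.symm i), ?_⟩
  ext x
  simp only [Set.mem_inter_iff, Set.mem_ofPred_eq]
  refine and_congr_right fun _ => ⟨fun h i => h _, fun h i => ?_⟩
  simpa using h (e i)

/-- The convex hull of finitely many nonempty polyhedra sharing the inequalities `f j x ≤ b j` is,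
up to closure, the linear image of a polyhedron with `card α * (nh + 1)` inequalities. -/
theorem exists_polyhedron_hull {l nh : ℕ} {α : Type} [Fintype α]
    (S : α → AffineSubspace ℝ (Fin l → ℝ)) (f : Fin nh → (Fin l → ℝ) →ₗ[ℝ] ℝ) (b : Fin nh → ℝ)
    (s : α → Fin l → ℝ) (hsS : ∀ i, s i ∈ S i) (hsf : ∀ i j, f j (s i) ≤ b j) :
    ∃ (l' : ℕ) (Q : Set (Fin l' → ℝ)) (ρ : (Fin l' → ℝ) →ₗ[ℝ] (Fin l → ℝ)),
      IsPolyhedronOfSize Q (Fintype.card α * (nh + 1)) ∧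
      (∀ i, ∀ x ∈ S i, (∀ j, f j x ≤ b j) → x ∈ ρ '' Q) ∧
      ∀ (h : (Fin l → ℝ) →ₗ[ℝ] ℝ) (β : ℝ),
        (∀ i, ∀ x ∈ S i, (∀ j, f j x ≤ b j) → h x ≤ β) → ∀ y ∈ ρ '' Q, h y ≤ β := by
  classical
  let ι := α × Option (Fin l)
  let lam : α → (ι → ℝ) →ₗ[ℝ] ℝ := fun i => LinearMap.proj (i, none)
  let pt : α → (ι → ℝ) →ₗ[ℝ] (Fin l → ℝ) := fun i =>
    LinearMap.pi fun c => LinearMap.proj (i, some c)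
  let W : AffineSubspace ℝ (ι → ℝ) :=
    (⨅ i, (S i).direction.comap (pt i - (lam i).smulRight (s i))).toAffineSubspace ⊓
      (AffineSubspace.mk' (1 : ℝ) ⊥).comap (∑ i, lam i).toAffineMap
  have hW : ∀ z, z ∈ W ↔ (∀ i, pt i z - lam i z • s i ∈ (S i).direction) ∧ ∑ i, lam i z = 1 := by
    intro z
    simp [W, AffineSubspace.mem_inf_iff, AffineSubspace.mem_mk', sub_eq_zero]
  let F : α × Option (Fin nh) → (ι → ℝ) →ₗ[ℝ] ℝ := fun p =>
    match p.2 with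
    | none => -lam p.1
    | some j => f j ∘ₗ pt p.1 - b j • lam p.1
  let P : Set (ι → ℝ) := (W : Set (ι → ℝ)) ∩ {z | ∀ p, F p z ≤ (0 : α × Option (Fin nh) → ℝ) p}
  have hP : ∀ z, z ∈ P ↔ z ∈ W ∧ ∀ i, 0 ≤ lam i z ∧ ∀ j, f j (pt i z) ≤ b j * lam i z := by
    intro z
    refine and_congr_right fun _ => ⟨fun h i => ⟨?_, fun j => ?_⟩, fun h => ?_⟩
    · simpa [F] using h (i, none)
    · simpa [F] using h (i, some j)
    · rintro ⟨i, _ | j⟩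
      · simpa [F] using (h i).1
      · simpa [F] using (h i).2 j
  have hPsize : IsPolyhedronOfSize P (Fintype.card α * (nh + 1)) := by
    have := isPolyhedronOfSize_of_fintype W F 0
    rw [Fintype.card_prod, Fintype.card_option, Fintype.card_fin] at this
    exact this
  let T : (Fin (Fintype.card ι) → ℝ) ≃ₗ[ℝ] (ι → ℝ) :=
    LinearEquiv.funCongrLeft ℝ ℝ (Fintype.equivFin ι)
  let ρ₀ : (ι → ℝ) →ₗ[ℝ] (Fin l → ℝ) := ∑ i, pt i
  refine ⟨Fintype.card ι, T.toLinearMap ⁻¹' P, ρ₀ ∘ₗ T.toLinearMap, hPsize.preimage _, ?_, ?_⟩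
  · intro i x hx hxf
    let z : ι → ℝ := fun p => if p.1 = i then p.2.elim 1 x else 0
    have hlam : ∀ i', lam i' z = if i' = i then 1 else 0 := fun i' => rfl
    have hpt : ∀ i', pt i' z = if i' = i then x else 0 := by
      intro i'
      ext c
      change (if i' = i then x c else 0) = _
      split_ifs <;> rfl
    refine ⟨T.symm z, ?_, ?_⟩
    · change T (T.symm z) ∈ P
      rw [T.apply_symm_apply, hP, hW]
      refine ⟨⟨fun i' => ?_, by simp [hlam]⟩, fun i' => ?_⟩
      · rw [hlam, hpt]
        split_ifs with h
        · subst h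
          simpa using AffineSubspace.vsub_mem_direction hx (hsS i')
        · simp
      · rw [hlam, hpt]
        split_ifs with h
        · simpa using hxf
        · simp
    · change ρ₀ (T (T.symm z)) = x
      rw [T.apply_symm_apply]
      simp [ρ₀, LinearMap.sum_apply, hpt]
  · rintro h β hβ _ ⟨u, hu, rfl⟩
    obtain ⟨hzW, hz⟩ := (hP _).1 (show T u ∈ P from hu)
    obtain ⟨hzd, hz1⟩ := (hW _).1 hzW
    change h (ρ₀ (T u)) ≤ β
    generalize T u = z at hzd hz1 hz
    have hpart : ∀ i, h (pt i z) ≤ lam i z * β := by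
      intro i
      have hlin : ∀ t : ℝ, 0 < t → h (pt i z) + t * h (s i) ≤ (lam i z + t) * β := by
        intro t ht
        have hpos : 0 < lam i z + t := by linarith [(hz i).1]
        have hmem : (lam i z + t)⁻¹ • (pt i z + t • s i) ∈ S i := by
          have h1 := AffineSubspace.vadd_mem_of_mem_direction
            ((S i).direction.smul_mem (lam i z + t)⁻¹ (hzd i)) (hsS i)
          convert h1 using 1
          rw [vadd_eq_add, inv_smul_eq_iff₀ hpos.ne', smul_add, smul_inv_smul₀ hpos.ne', add_smul]
          abel
        have hle : ∀ j, f j ((lam i z + t)⁻¹ • (pt i z + t • s i)) ≤ b j := by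
          intro j
          rw [map_smul, map_add, map_smul, smul_eq_mul, smul_eq_mul, inv_mul_le_iff₀ hpos]
          nlinarith [(hz i).2 j, mul_le_mul_of_nonneg_left (hsf i j) ht.le]
        have := hβ i _ hmem hle
        rwa [map_smul, map_add, map_smul, smul_eq_mul, smul_eq_mul, inv_mul_le_iff₀ hpos] at this
      have hsβ := hβ i (s i) (hsS i) (hsf i)
      refine le_of_forall_pos_le_add fun η hη => ?_
      have hden : 0 < β - h (s i) + 1 := by linarith
      have h1 := hlin (η / (β - h (s i) + 1)) (by positivity)
      have h2 : η / (β - h (s i) + 1) * (β - h (s i) + 1) = η := div_mul_cancel₀ _ hden.ne'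
      have h3 : 0 < η / (β - h (s i) + 1) := by positivity
      nlinarith
    calc h (ρ₀ z) = ∑ i, h (pt i z) := by simp [ρ₀, LinearMap.sum_apply]
      _ ≤ ∑ i, lam i z * β := Finset.sum_le_sum fun i _ => hpart i
      _ = β := by rw [← Finset.sum_mul, hz1, one_mul]

/-- The integer lattice `ℤ^k` inside `ℝ^k`. -/
def latticePoints (k : ℕ) : Submodule ℤ (Fin k → ℝ) where
  carrier := {z | IsLatticePoint z}
  zero_mem' := fun _ => ⟨0, by simp⟩
  add_mem' := fun {x y} hx hy i => by
    obtain ⟨m, hm⟩ := hx i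
    obtain ⟨n, hn⟩ := hy i
    exact ⟨m + n, by simp [hm, hn]⟩
  smul_mem' := fun c x hx i => by
    obtain ⟨m, hm⟩ := hx i
    exact ⟨c * m, by simp [hm]⟩

theorem mem_latticePoints {k : ℕ} {z : Fin k → ℝ} : z ∈ latticePoints k ↔ IsLatticePoint z :=
  Iff.rfl

theorem finiteInBalls_latticePoints (k : ℕ) : FiniteInBalls (latticePoints k) := by
  intro r
  refine (Set.Finite.pi' fun _ : Fin k => finite_setOf_eq_intCast_abs_le r).subset ?_
  rintro x ⟨hx, hxr⟩ i
  exact ⟨hx i, (norm_le_pi_norm x i).trans hxr⟩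

theorem isLEF_of_lift {ι : Type*} {C : Set (ι → ℝ)} (hC : Convex ℝ C) {ε δ : ℝ} (hε : 0 ≤ ε)
    (hε1 : ε ≤ 1) (hδ : 0 < δ) {l l' m : ℕ} {X : Set (Fin l → ℝ)}
    {π : (Fin l → ℝ) →ᵃ[ℝ] (ι → ℝ)} (hCX : C ⊆ convexHull ℝ (π '' X))
    (hdist : relDist C (convexHull ℝ (π '' X)) ≤ ENNReal.ofReal ε)
    {Q : Set (Fin l' → ℝ)} (hQ : IsPolyhedronOfSize Q m) (ρ : (Fin l' → ℝ) →ₗ[ℝ] (Fin l → ℝ))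
    (hXQ : X ⊆ ρ '' Q)
    (hρ : ∀ (h : (Fin l → ℝ) →ₗ[ℝ] ℝ) (a b : ℝ), (∀ x ∈ X, a ≤ h x ∧ h x ≤ b) →
      ∀ y ∈ ρ '' Q, h y ≤ b + δ / 3 * (b - a)) : IsLEF C (ε + δ) m := by
  have himage : (π.comp ρ.toAffineMap) '' Q = π '' (ρ '' Q) := by
    rw [Set.image_image]
    rfl
  have hconv : Convex ℝ ((π.comp ρ.toAffineMap) '' Q) := hQ.convex.affine_image _
  refine ⟨l', Q, π.comp ρ.toAffineMap, hQ, ?_, ?_⟩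
  · refine hCX.trans (convexHull_min ?_ hconv)
    rw [himage]
    exact Set.image_mono hXQ
  · refine relDist_le_add hC hε hε1 hδ hdist fun g a b hab y hy => ?_
    rw [himage] at hy
    obtain ⟨x, hx, rfl⟩ := hy
    have hπ : ∀ x, π x = π.linear x + π 0 := fun x => by
      have := π.map_vadd 0 x
      simpa using this
    have h1 := hρ (g ∘ₗ π.linear) (a - g (π 0)) (b - g (π 0)) (fun z hz => by
      have := hab (π z) (subset_convexHull ℝ _ ⟨z, hz, rfl⟩)
      rw [hπ z, map_add] at this
      simp only [LinearMap.comp_apply]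
      constructor <;> linarith [this.1, this.2]) x hx
    simp only [LinearMap.comp_apply] at h1
    rw [hπ x, map_add]
    linarith

theorem le_of_mem_affineSpan_of_lattice {E : Type*} [AddCommGroup E] [Module ℝ E] {k : ℕ}
    (S : AffineSubspace ℝ E) (σ : E →ᵃ[ℝ] (Fin k → ℝ)) (h : E →ₗ[ℝ] ℝ) {b : ℝ}
    (hb : ∀ x ∈ S, IsLatticePoint (σ x) → h x ≤ b) :
    ∀ y ∈ affineSpan ℝ {x | x ∈ S ∧ IsLatticePoint (σ x)}, h y ≤ b := by
  intro y hy
  obtain ⟨x₀, hx₀⟩ : {x | x ∈ S ∧ IsLatticePoint (σ x)}.Nonempty :=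
    (affineSpan_nonempty ℝ).1 ⟨y, hy⟩
  have hle : ∀ x x', x ∈ S → IsLatticePoint (σ x) → x' ∈ S → IsLatticePoint (σ x') →
      h x' ≤ h x := by
    intro x x' hx hσx hx' hσx'
    by_contra! hlt
    obtain ⟨n, hn⟩ := exists_nat_gt ((b - h x) / (h x' - h x))
    rw [div_lt_iff₀ (by linarith)] at hn
    have h1 : AffineMap.lineMap x x' (n : ℝ) ∈ S := AffineMap.lineMap_mem _ hx hx'
    have h2 : IsLatticePoint (σ (AffineMap.lineMap x x' (n : ℝ))) := by
      rw [AffineMap.apply_lineMap, ← mem_latticePoints, AffineMap.lineMap_apply, vsub_eq_sub,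
        vadd_eq_add, Nat.cast_smul_eq_nsmul]
      exact add_mem (nsmul_mem (sub_mem (mem_latticePoints.2 hσx') (mem_latticePoints.2 hσx)) n)
        (mem_latticePoints.2 hσx)
    have h3 := hb _ h1 h2
    rw [AffineMap.lineMap_apply, vsub_eq_sub, vadd_eq_add, map_add, map_smul, map_sub,
      smul_eq_mul] at h3
    linarith
  have hspan : affineSpan ℝ {x | x ∈ S ∧ IsLatticePoint (σ x)} ≤
      (AffineSubspace.mk' (h x₀) ⊥).comap h.toAffineMap := by
    refine affineSpan_le.2 fun x hx => ?_
    have := le_antisymm (hle x₀ x hx₀.1 hx₀.2 hx.1 hx.2) (hle x x₀ hx.1 hx.2 hx₀.1 hx₀.2)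
    simp [AffineSubspace.mem_mk', this]
  have hyx : h y = h x₀ := by
    have := hspan hy
    simpa [AffineSubspace.mem_mk', sub_eq_zero] using this
  exact hyx ▸ hb x₀ hx₀.1 hx₀.2

theorem two_mul_ceil_pow_le_one_add_div_pow {k : ℕ} (hk : 1 ≤ k) {δ : ℝ} (hδ : 0 < δ)
    (hδ1 : δ ≤ 1) :
    2 * (⌈2 * (12 * (k : ℝ) ^ 4 / (δ / 3)) + 1⌉₊ : ℝ) ^ k ≤ (1 + (k : ℝ) / δ) ^ (12 * k) := by
  have hk' : (1 : ℝ) ≤ k := by exact_mod_cast hk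
  set s := 1 + (k : ℝ) / δ with hs
  have hks : (k : ℝ) / δ ≤ s := by linarith
  have hkδ : (k : ℝ) ≤ k / δ := le_div_self (by linarith) hδ hδ1
  have hs2 : 2 ≤ s := by linarith
  have hM : (⌈2 * (12 * (k : ℝ) ^ 4 / (δ / 3)) + 1⌉₊ : ℝ) ≤ s ^ 11 := by
    have h1 := (Nat.ceil_lt_add_one
      (by positivity : 0 ≤ 2 * (12 * (k : ℝ) ^ 4 / (δ / 3)) + 1)).le
    have h2 : (k : ℝ) ^ 4 / δ ≤ s ^ 4 := by
      calc (k : ℝ) ^ 4 / δ = k ^ 3 * (k / δ) := by ring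
        _ ≤ s ^ 3 * s := by gcongr; linarith
        _ = s ^ 4 := by ring
    have h3 : 2 * (12 * (k : ℝ) ^ 4 / (δ / 3)) = 72 * (k ^ 4 / δ) := by
      field_simp
      norm_num
    have h4 : (16 : ℝ) ≤ s ^ 4 := by
      calc (16 : ℝ) = 2 ^ 4 := by norm_num
        _ ≤ s ^ 4 := by gcongr
    have h5 : (128 : ℝ) ≤ s ^ 7 := by
      calc (128 : ℝ) = 2 ^ 7 := by norm_num
        _ ≤ s ^ 7 := by gcongr
    calc (⌈2 * (12 * (k : ℝ) ^ 4 / (δ / 3)) + 1⌉₊ : ℝ) ≤ 128 * s ^ 4 := by linarith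
      _ ≤ s ^ 7 * s ^ 4 := by gcongr
      _ = s ^ 11 := by ring
  calc 2 * (⌈2 * (12 * (k : ℝ) ^ 4 / (δ / 3)) + 1⌉₊ : ℝ) ^ k ≤ s * (s ^ 11) ^ k := by gcongr
    _ = s ^ (11 * k + 1) := by rw [← pow_mul, ← pow_succ']
    _ ≤ s ^ (12 * k) := by
      gcongr
      · linarith
      · omega

theorem IsMILEF.exists_isLEF {ι : Type*} {C : Set (ι → ℝ)} (hC : Convex ℝ C) {ε δ : ℝ}
    (hε : 0 ≤ ε) (hε1 : ε ≤ 1) {m k : ℕ} (hk : 1 ≤ k) (h : IsMILEF C ε m k) (hδ : 0 < δ)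
    (hδ1 : δ ≤ 1) :
    ∃ m' : ℕ, (m' : ℝ) ≤ (m : ℝ) * (1 + (k : ℝ) / δ) ^ (12 * k) ∧ IsLEF C (ε + δ) m' := by
  classical
  obtain ⟨l, Q, σ, π, hQ, hCX, hdist⟩ := h
  have hQconv := hQ.convex
  obtain ⟨S, nh, hnh, f, b, rfl⟩ := hQ
  set Q := (S : Set (Fin l → ℝ)) ∩ {x | ∀ i, f i x ≤ b i} with hQdef
  set X := Q ∩ {x | IsLatticePoint (σ x)} with hX
  rcases Nat.eq_zero_or_pos nh with rfl | hnhpos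
  · refine ⟨0, by simp only [Nat.cast_zero]; positivity, ?_⟩
    have hXS : X = {x | x ∈ S ∧ IsLatticePoint (σ x)} := by
      ext x
      simp [hX, hQdef]
    have hsize : IsPolyhedronOfSize (affineSpan ℝ X : Set (Fin l → ℝ)) 0 :=
      ⟨affineSpan ℝ X, 0, le_rfl, f, b, by simp⟩
    refine isLEF_of_lift hC hε hε1 hδ hCX hdist hsize LinearMap.id ?_ ?_
    · simpa using subset_affineSpan ℝ X
    · rintro g a β hab _ ⟨y, hy, rfl⟩
      obtain ⟨x₀, hx₀⟩ : X.Nonempty := (affineSpan_nonempty ℝ).1 ⟨y, hy⟩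
      have h1 : g y ≤ β := by
        rw [hXS] at hy hab
        exact le_of_mem_affineSpan_of_lattice S σ g (fun x hx hσ => (hab x ⟨hx, hσ⟩).2) y hy
      have h2 := hab x₀ hx₀
      have h3 : 0 ≤ δ / 3 * (β - a) := mul_nonneg (by linarith) (by linarith)
      simp only [LinearMap.id_apply]
      linarith
  · set M := ⌈2 * (12 * (k : ℝ) ^ 4 / (δ / 3)) + 1⌉₊ with hM
    obtain ⟨𝒮, hcard, hcover, hbound⟩ := exists_affineSubspaces_cover (δ := δ / 3) (by linarith)
      (by linarith) k M (Nat.le_ceil _) k le_rfl (Fin k → ℝ) (by simp) (latticePoints k)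
      (finiteInBalls_latticePoints k) σ Q hQconv
    let 𝒯 : Finset (AffineSubspace ℝ (Fin l → ℝ)) :=
      𝒮.filter fun S' => (Q ∩ (S' : Set (Fin l → ℝ))).Nonempty
    have hpt : ∀ i : 𝒯, (Q ∩ ((i : AffineSubspace ℝ (Fin l → ℝ)) : Set (Fin l → ℝ))).Nonempty :=
      fun i => (Finset.mem_filter.1 i.2).2
    choose s hs using hpt
    obtain ⟨l', P, ρ, hP, hPX, hPle⟩ := exists_polyhedron_hull (α := 𝒯) (fun i => S ⊓ i.1) f b s
      (fun i => (AffineSubspace.mem_inf_iff _ _ _).2 ⟨(hs i).1.1, (hs i).2⟩) (fun i => (hs i).1.2)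
    refine ⟨Fintype.card 𝒯 * (nh + 1), ?_, isLEF_of_lift hC hε hε1 hδ hCX hdist hP ρ ?_ ?_⟩
    · have h1 : Fintype.card 𝒯 ≤ M ^ k := by
        rw [Fintype.card_coe]
        exact (Finset.card_filter_le _ _).trans hcard
      have h2 : Fintype.card 𝒯 * (nh + 1) ≤ m * (2 * M ^ k) :=
        calc Fintype.card 𝒯 * (nh + 1) ≤ M ^ k * (2 * m) := Nat.mul_le_mul h1 (by omega)
          _ = m * (2 * M ^ k) := by ring
      calc ((Fintype.card 𝒯 * (nh + 1) : ℕ) : ℝ) ≤ (m * (2 * M ^ k) : ℕ) := by exact_mod_cast h2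
        _ = m * (2 * (M : ℝ) ^ k) := by push_cast; rfl
        _ ≤ m * (1 + (k : ℝ) / δ) ^ (12 * k) := by
          gcongr
          exact two_mul_ceil_pow_le_one_add_div_pow hk hδ hδ1
    · rintro x ⟨hxQ, hxσ⟩
      obtain ⟨S', hS', hxS'⟩ := hcover x hxQ hxσ
      exact hPX ⟨S', Finset.mem_filter.2 ⟨hS', x, hxQ, hxS'⟩⟩ x
        ((AffineSubspace.mem_inf_iff _ _ _).2 ⟨hxQ.1, hxS'⟩) hxQ.2
    · intro g a β hab
      refine hPle g _ fun i x hx hxf => ?_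
      obtain ⟨hxS, hxi⟩ := (AffineSubspace.mem_inf_iff _ _ _).1 hx
      exact hbound i.1 (Finset.mem_filter.1 i.2).1 g a β (fun y hy hyσ => hab y ⟨hy, hyσ⟩) x
        ⟨hxS, hxf⟩ hxi

/-- If a convex set `C ⊆ ℝ^d` admits an `ε`-MILEF of complexity `(m,k)`
with `k ≥ 1` and `ε ∈ [0,1]`, then there is a universal constant `c > 0` such that for every
`δ ∈ (0,1]`, `C` admits an `(ε+δ)`-LEF of size at most `m · (1 + k/δ)^(c·k)`. -/
theorem milef_to_lef :
    ∃ c : ℝ, 0 < c ∧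
      ∀ (d : ℕ) (C : Set (Fin d → ℝ)), Convex ℝ C →
        ∀ ε : ℝ, 0 ≤ ε → ε ≤ 1 →
          ∀ m k : ℕ, 1 ≤ k → IsMILEF C ε m k →
            ∀ δ : ℝ, 0 < δ → δ ≤ 1 →
              ∃ m' : ℕ, (m' : ℝ) ≤ (m : ℝ) * (1 + (k : ℝ) / δ) ^ (c * (k : ℝ)) ∧
                IsLEF C (ε + δ) m' := by
  refine ⟨12, by norm_num, fun d C hC ε hε hε1 m k hk h δ hδ hδ1 => ?_⟩
  obtain ⟨m', hm', hLEF⟩ := h.exists_isLEF hC hε hε1 hk hδ hδ1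
  refine ⟨m', ?_, hLEF⟩
  have hcast : (12 : ℝ) * (k : ℝ) = ((12 * k : ℕ) : ℝ) := by push_cast; rfl
  rwa [hcast, Real.rpow_natCast]
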